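/- Let ε > -1/2 with ε ≠ 0. Then ((1+ε)/√(1+2ε))ⁿ → ∞ as n → ∞; that is, for a fixed nonzero relative covariance error ε, the quality measure R of Gaussian importance sampling tends to infinity exponentially as the dimension n of the parameter vector increases. -/

import Mathlib

open Real Filter

/-- For a fixed `ε > -1/2` with `ε ≠ 0`, the quality measure
`((1+ε)/√(1+2ε))ⁿ` tends to infinity as the dimension `n → ∞`. -/
theorem quality_measure_tendsto_atTop (ε : ℝ) (hε : ε > -1/2) (hε0 : ε ≠ 0) :
    Tendsto (fun n : ℕ => ((1 + ε) / Real.sqrt (1 + 2 * ε)) ^ n) atTop atTop := by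
  have hpos : 0 < 1 + 2 * ε := by linarith
  refine tendsto_pow_atTop_atTop_of_one_lt ?_
  rw [one_lt_div (Real.sqrt_pos.2 hpos), Real.sqrt_lt' (by linarith)]
  nlinarith [sq_pos_of_ne_zero hε0]
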